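/- Let b be a rational function in the closed unit ball of H∞ with ‖b‖∞ = 1 that is not a finite Blaschke product. If φ ∈ H(b) and 1/φ ∈ H∞, then 1/φ is a multiplier of H(b), i.e. (1/φ)·f ∈ H(b) for every f ∈ H(b). -/

import Mathlib

open Complex MeasureTheory Set Filter

noncomputable section

attribute [local instance] Classical.propDecidable

/-- The open unit disk in `ℂ`. -/
def unitDisk : Set ℂ := Metric.ball 0 1

/-- The unit circle in `ℂ`. -/
def unitCircle : Set ℂ := Metric.sphere 0 1

/-- Membership in `H^∞`: analytic and bounded on the unit disk. -/
def MemHinf (f : ℂ → ℂ) : Prop :=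
  DifferentiableOn ℂ f unitDisk ∧ ∃ C : ℝ, ∀ z ∈ unitDisk, ‖f z‖ ≤ C

/-- Membership in the closed unit ball of `H^∞`. -/
def MemBallHinf (f : ℂ → ℂ) : Prop :=
  DifferentiableOn ℂ f unitDisk ∧ ∀ z ∈ unitDisk, ‖f z‖ ≤ 1

/-- `f` agrees on the closed unit disk with a rational function without poles there. -/
def IsRationalOnDisk (f : ℂ → ℂ) : Prop :=
  ∃ P Q : Polynomial ℂ, ∀ z ∈ Metric.closedBall (0:ℂ) 1,
    Q.eval z ≠ 0 ∧ f z = P.eval z / Q.eval z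

/-- `f` is a finite Blaschke product (multiplicities are encoded by repetition). -/
def IsFiniteBlaschke (f : ℂ → ℂ) : Prop :=
  ∃ (γ : ℂ) (k : ℕ) (lam : Fin k → ℂ), ‖γ‖ = 1 ∧ (∀ i, lam i ∈ unitDisk) ∧
    ∀ z ∈ unitDisk, f z = γ * ∏ i, (z - lam i) / (1 - (starRingEnd ℂ) (lam i) * z)

/-- The `k`-th Taylor coefficient of `f` at the origin. -/
def taylorCoeff (f : ℂ → ℂ) (k : ℕ) : ℂ := iteratedDeriv k f 0 / k.factorial

/-- Membership in the Hardy space `H²` (square-summable Taylor coefficients). -/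
def MemH2 (f : ℂ → ℂ) : Prop :=
  DifferentiableOn ℂ f unitDisk ∧ Summable fun k => ‖taylorCoeff f k‖ ^ 2

/-- The squared `H²` norm. -/
def h2NormSq (f : ℂ → ℂ) : ℝ := ∑' k, ‖taylorCoeff f k‖ ^ 2

/-- The `H²` inner product. -/
def h2Inner (f g : ℂ → ℂ) : ℂ :=
  ∑' k, (starRingEnd ℂ) (taylorCoeff f k) * taylorCoeff g k

/-- The polynomial `a₁(z) = ∏ⱼ (z − ξⱼ)^{mⱼ}`. -/
def a1fun {n : ℕ} (ξ : Fin n → ℂ) (m : Fin n → ℕ) : ℂ → ℂ :=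
  fun z => ∏ j, (z - ξ j) ^ (m j)

/-- A decomposition `f = a₁ g + q` with `g ∈ H²`, `deg q ≤ N − 1`, witnessing membership
in `H(b) = a₁H² ⊕ P_{N−1}`. -/
def HbDecompOf {n : ℕ} (ξ : Fin n → ℂ) (m : Fin n → ℕ)
    (f g : ℂ → ℂ) (q : Polynomial ℂ) : Prop :=
  MemH2 g ∧ q.degree < ((∑ j, m j : ℕ) : WithBot ℕ) ∧
    ∀ z ∈ unitDisk, f z = a1fun ξ m z * g z + q.eval z

/-- Membership in `H(b) = a₁ H² ⊕ P_{N−1}` (description of `H(b)` for `b` rational,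
not a finite Blaschke product, whose pythagorean mate has boundary zeros `ξ` with
multiplicities `m`). -/
def MemHb {n : ℕ} (ξ : Fin n → ℂ) (m : Fin n → ℕ) (f : ℂ → ℂ) : Prop :=
  ∃ gq : (ℂ → ℂ) × Polynomial ℂ, HbDecompOf ξ m f gq.1 gq.2

/-- The (unique) decomposition of a member of `H(b)`. -/
def hbDecomp {n : ℕ} (ξ : Fin n → ℂ) (m : Fin n → ℕ) (f : ℂ → ℂ) :
    (ℂ → ℂ) × Polynomial ℂ :=
  if h : MemHb ξ m f then h.choose else (0, 0)

/-- The squared norm `⦀a₁g + q⦀² = ‖g‖²_{H²} + ‖q‖²_{H²}` on `H(b)`. -/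
def hbNormSq {n : ℕ} (ξ : Fin n → ℂ) (m : Fin n → ℕ) (f : ℂ → ℂ) : ℝ :=
  h2NormSq (hbDecomp ξ m f).1 + h2NormSq fun z => ((hbDecomp ξ m f).2).eval z

/-- The inner product on `H(b)` induced by the decomposition. -/
def hbInner {n : ℕ} (ξ : Fin n → ℂ) (m : Fin n → ℕ) (f g : ℂ → ℂ) : ℂ :=
  h2Inner (hbDecomp ξ m f).1 (hbDecomp ξ m g).1 +
    h2Inner (fun z => ((hbDecomp ξ m f).2).eval z)
      (fun z => ((hbDecomp ξ m g).2).eval z)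

/-- The Stolz angle (non-tangential approach region) at a boundary point `ξ`. -/
def stolzAngle (ξ : ℂ) (M : ℝ) : Set ℂ := {z ∈ unitDisk | ‖z - ξ‖ ≤ M * (1 - ‖z‖)}

/-- `f` has non-tangential limit `L` at `ξ`. -/
def NTLimit (f : ℂ → ℂ) (ξ L : ℂ) : Prop :=
  ∀ M : ℝ, 1 < M → Tendsto f (nhdsWithin ξ (stolzAngle ξ M)) (nhds L)

/-- Radial boundary value of `f` at `ζ` (junk value if the radial limit does not exist). -/
def bdryVal (f : ℂ → ℂ) (ζ : ℂ) : ℂ :=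
  limUnder (nhdsWithin (1:ℝ) (Set.Iio 1)) fun r : ℝ => f ((r : ℂ) * ζ)

/-- The full setting: `b` is a rational function in the closed unit ball of `H^∞` with
`‖b‖_∞ = 1` which is not a finite Blaschke product; `a` is its pythagorean mate (rational,
outer — i.e. zero-free on the disk —, `a(0) > 0`, `|a|² + |b|² = 1` on the circle); the
`ξ j` are the distinct zeros of `a` on the unit circle, with multiplicities `m j`. -/
structure RationalSetting (b a : ℂ → ℂ) (n : ℕ) (ξ : Fin n → ℂ) (m : Fin n → ℕ) :
    Prop where
  b_diff : DifferentiableOn ℂ b unitDisk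
  b_rat : IsRationalOnDisk b
  b_le_one : ∀ z ∈ unitDisk, ‖b z‖ ≤ 1
  b_norm_one : sSup ((fun z => ‖b z‖) '' unitDisk) = 1
  b_not_fbp : ¬ IsFiniteBlaschke b
  a_diff : DifferentiableOn ℂ a unitDisk
  a_rat : IsRationalOnDisk a
  a_outer : ∀ z ∈ unitDisk, a z ≠ 0
  a_zero_pos : 0 < (a 0).re ∧ (a 0).im = 0
  pyth : ∀ ζ ∈ unitCircle, ‖a ζ‖ ^ 2 + ‖b ζ‖ ^ 2 = 1
  zeros_mem : ∀ j, ξ j ∈ unitCircle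
  zeros_inj : Function.Injective ξ
  mult_pos : ∀ j, 0 < m j
  factor : ∃ g : ℂ → ℂ, IsRationalOnDisk g ∧ (∀ ζ ∈ unitCircle, g ζ ≠ 0) ∧
    ∀ z ∈ Metric.closedBall (0:ℂ) 1, a z = a1fun ξ m z * g z

/-- The composition operator `C_φ` maps `H(b)` into itself and is bounded there
(with respect to the equivalent norm `⦀·⦀_b`). -/
def CompBddHb {n : ℕ} (ξ : Fin n → ℂ) (m : Fin n → ℕ) (φ : ℂ → ℂ) : Prop :=
  (∀ f, MemHb ξ m f → MemHb ξ m fun z => f (φ z)) ∧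
  ∃ C : ℝ, ∀ f, MemHb ξ m f →
    hbNormSq ξ m (fun z => f (φ z)) ≤ C * hbNormSq ξ m f

/-- The composition operator `C_φ` is compact on `H(b)`: it is bounded and the image of
every sequence in the unit ball has a subsequence whose image converges in `H(b)`. -/
def CompCompactHb {n : ℕ} (ξ : Fin n → ℂ) (m : Fin n → ℕ) (φ : ℂ → ℂ) : Prop :=
  CompBddHb ξ m φ ∧
  ∀ f : ℕ → ℂ → ℂ, (∀ k, MemHb ξ m (f k) ∧ hbNormSq ξ m (f k) ≤ 1) →
    ∃ (κ : ℕ → ℕ) (g : ℂ → ℂ), StrictMono κ ∧ MemHb ξ m g ∧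
      Tendsto (fun i => hbNormSq ξ m fun z => f (κ i) (φ z) - g z) atTop (nhds 0)

/-- The composition operator `C_φ` is Hilbert–Schmidt on `H(b)`: it is bounded and the sum
of `⦀C_φ e⦀²` over the orthonormal basis `{a₁ z^k}ₖ ∪ {z^j}_{j<N}` of
`(H(b), ⦀·⦀_b)` is finite (the finite part of the sum being automatically finite). -/
def CompHSHb {n : ℕ} (ξ : Fin n → ℂ) (m : Fin n → ℕ) (φ : ℂ → ℂ) : Prop :=
  CompBddHb ξ m φ ∧
  Summable fun k : ℕ => hbNormSq ξ m fun z => a1fun ξ m (φ z) * φ z ^ k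

/-- The weighted composition operator `W_{u,φ} f = u · (f ∘ φ)` maps `H²` boundedly
into itself. -/
def WCompBddH2 (u φ : ℂ → ℂ) : Prop :=
  (∀ f, MemH2 f → MemH2 fun z => u z * f (φ z)) ∧
  ∃ C : ℝ, ∀ f, MemH2 f →
    h2NormSq (fun z => u z * f (φ z)) ≤ C * h2NormSq f

/-- The weighted composition operator `W_{u,φ}` is compact on `H²`. -/
def WCompCompactH2 (u φ : ℂ → ℂ) : Prop :=
  WCompBddH2 u φ ∧
  ∀ f : ℕ → ℂ → ℂ, (∀ k, MemH2 (f k) ∧ h2NormSq (f k) ≤ 1) →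
    ∃ (κ : ℕ → ℕ) (g : ℂ → ℂ), StrictMono κ ∧ MemH2 g ∧
      Tendsto (fun i => h2NormSq fun z => u z * f (κ i) (φ z) - g z) atTop (nhds 0)

/-- The weighted composition operator `W_{u,φ}` is Hilbert–Schmidt on `H²`
(sum over the orthonormal basis `{z^k}` of `H²`). -/
def WCompHSH2 (u φ : ℂ → ℂ) : Prop :=
  WCompBddH2 u φ ∧ Summable fun k : ℕ => h2NormSq fun z => u z * φ z ^ k

/-- The function `u = (a₁ ∘ φ) · ∏_{j ≥ p} (φ − φ(ξⱼ))^{mⱼ} / a₁`, where `Λ j = φ(ξ j)`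
are the non-tangential limits of `φ` at the zeros of the mate. -/
def ufun {n : ℕ} (p : ℕ) (ξ : Fin n → ℂ) (m : Fin n → ℕ) (Λ : Fin n → ℂ)
    (φ : ℂ → ℂ) : ℂ → ℂ :=
  fun z => a1fun ξ m (φ z) *
    (∏ j ∈ Finset.univ.filter fun j : Fin n => p ≤ (j : ℕ), (φ z - Λ j) ^ (m j)) /
      a1fun ξ m z

/-- The reproducing kernel of the de Branges–Rovnyak space `H(c)`:
`k_λ^c(z) = (1 − conj(c(λ)) c(z)) / (1 − conj(λ) z)`, as a function of the parameter `λ`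
and the evaluation point `z`. -/
def rkKernel (c : ℂ → ℂ) (lam z : ℂ) : ℂ :=
  (1 - (starRingEnd ℂ) (c lam) * c z) / (1 - (starRingEnd ℂ) lam * z)

/-- `f` belongs to the reproducing kernel Hilbert space `H(c)` with squared norm at
most `t`: for all finite linear combinations of kernels,
`|⟨f, Σ αᵢ k_{λᵢ}⟩|² ≤ t · ‖Σ αᵢ k_{λᵢ}‖²`. -/
def HbRKBound (c f : ℂ → ℂ) (t : ℝ) : Prop :=
  ∀ (k : ℕ) (lam α : Fin k → ℂ), (∀ i, lam i ∈ unitDisk) →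
    ‖∑ i, (starRingEnd ℂ) (α i) * f (lam i)‖ ^ 2 ≤
      t * (∑ i, ∑ j, α i * (starRingEnd ℂ) (α j) * rkKernel c (lam i) (lam j)).re

/-- Membership in the de Branges–Rovnyak space `H(c)` (general RKHS definition). -/
def MemHbRK (c f : ℂ → ℂ) : Prop := ∃ t : ℝ, HbRKBound c f t

/-- `φ` has an angular derivative in the sense of Carathéodory at `ξ`:
`φ` and `φ'` have non-tangential limits at `ξ` and `|φ(ξ)| = 1`. -/
def HasADC (φ : ℂ → ℂ) (ξ : ℂ) : Prop :=
  ∃ L L' : ℂ, ‖L‖ = 1 ∧ NTLimit φ ξ L ∧ NTLimit (deriv φ) ξ L'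

/-- The measure `μ_{u,φ}(E) = ∫_{φ⁻¹(E) ∩ T} |u|² dm` (boundary values on the circle,
normalized Lebesgue measure). -/
def muMeas (u φ : ℂ → ℂ) (E : Set ℂ) : ENNReal :=
  (ENNReal.ofReal (2 * Real.pi))⁻¹ *
    ∫⁻ θ in Set.Ioc (0:ℝ) (2 * Real.pi),
      (if bdryVal φ (Complex.exp (θ * Complex.I)) ∈ E then
        ENNReal.ofReal (‖bdryVal u (Complex.exp (θ * Complex.I))‖ ^ 2) else 0)

/-- `μ_{u,φ}` is a Carleson measure: `μ(S(ζ,r)) ≤ M r` for all Carleson windows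
`S(ζ,r) = {z : |z| ≤ 1, |z − ζ| ≤ r}`, `ζ ∈ T`, `0 < r < 1`. -/
def IsCarleson (u φ : ℂ → ℂ) : Prop :=
  ∃ M : ℝ, 0 < M ∧ ∀ ζ ∈ unitCircle, ∀ r ∈ Set.Ioo (0:ℝ) 1,
    muMeas u φ (Metric.closedBall ζ r ∩ Metric.closedBall 0 1) ≤ ENNReal.ofReal (M * r)

/-- `μ_{u,φ}` is a vanishing Carleson measure: `sup_{ζ∈T} μ(S(ζ,r))/r → 0` as `r → 0`. -/
def IsVanishingCarleson (u φ : ℂ → ℂ) : Prop :=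
  ∀ ε > (0:ℝ), ∃ r₀ ∈ Set.Ioo (0:ℝ) 1, ∀ r ∈ Set.Ioo (0:ℝ) r₀, ∀ ζ ∈ unitCircle,
    muMeas u φ (Metric.closedBall ζ r ∩ Metric.closedBall 0 1) ≤ ENNReal.ofReal (ε * r)

/-- The reproducing kernel integral
`∫_T (1 − |w|²) |u(ξ)|² / |1 − conj(w) φ(ξ)|² dm(ξ)`. -/
def repKerInt (u φ : ℂ → ℂ) (w : ℂ) : ENNReal :=
  (ENNReal.ofReal (2 * Real.pi))⁻¹ *
    ∫⁻ θ in Set.Ioc (0:ℝ) (2 * Real.pi),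
      ENNReal.ofReal ((1 - ‖w‖ ^ 2) * ‖bdryVal u (Complex.exp (θ * Complex.I))‖ ^ 2 /
        ‖1 - (starRingEnd ℂ) w * bdryVal φ (Complex.exp (θ * Complex.I))‖ ^ 2)

theorem aux_hasSum {f : ℂ → ℂ} (hf : DifferentiableOn ℂ f unitDisk) {z : ℂ}
    (hz : z ∈ unitDisk) : HasSum (fun k => taylorCoeff f k * z ^ k) (f z) := by
  have := Complex.hasSum_taylorSeries_on_ball (c := 0) (r := 1) hf hz
  have h2 : (fun k => taylorCoeff f k * z ^ k) =
      fun n : ℕ => ((n.factorial : ℂ))⁻¹ • (z - 0) ^ n • iteratedDeriv n f 0 := by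
    funext k
    simp only [taylorCoeff, sub_zero, smul_eq_mul]
    ring
  rw [h2]
  exact this

/-- The dilate `t ↦ f (r e^{it})` in `L²` of the circle, with its norm. -/
theorem aux_parseval {f : ℂ → ℂ} (hf : DifferentiableOn ℂ f unitDisk) {r : ℝ}
    (h0 : 0 ≤ r) (h1 : r < 1) :
    ∃ F : C(AddCircle (1:ℝ), ℂ),
      (∀ t, F t = f ((r : ℂ) * (AddCircle.toCircle t : ℂ))) ∧
      HasSum (fun k => ‖taylorCoeff f k‖ ^ 2 * r ^ (2 * k))
        (‖ContinuousMap.toLp (E := ℂ) 2 (AddCircle.haarAddCircle (T := 1)) ℂ F‖ ^ 2) := by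
  have hr : (r : ℂ) ∈ unitDisk := by
    simp [unitDisk, abs_of_nonneg h0, h1]
  have hs : Summable (fun k => ‖taylorCoeff f k * (r:ℂ) ^ k‖) := (aux_hasSum hf hr).summable.norm
  have hs2 : Summable (fun k : ℕ => (taylorCoeff f k * (r:ℂ) ^ k) •
      (fourier (k : ℤ) : C(AddCircle (1:ℝ), ℂ))) := by
    apply Summable.of_norm
    refine hs.congr fun k => ?_
    rw [norm_smul, fourier_norm, mul_one]
  refine ⟨∑' k : ℕ, (taylorCoeff f k * (r:ℂ) ^ k) •
      (fourier (k : ℤ) : C(AddCircle (1:ℝ), ℂ)), fun t => ?_, ?_⟩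
  · have h2 := ContinuousMap.hasSum_apply hs2.hasSum t
    have hz : (r : ℂ) * (AddCircle.toCircle t : ℂ) ∈ unitDisk := by
      simp [unitDisk, abs_of_nonneg h0, h1, Circle.norm_coe]
    refine h2.unique ?_
    convert aux_hasSum hf hz using 2 with k
    simp [fourier_apply, AddCircle.toCircle_nsmul, mul_pow, mul_assoc]
  · have h3 := hs2.hasSum.mapL (ContinuousMap.toLp (E := ℂ) 2 (AddCircle.haarAddCircle (T := 1)) ℂ)
    have h4 := (h3.norm.pow 2)
    refine h4.congr fun s => ?_
    have ho : Orthonormal ℂ (fun k : ℕ => (fourierLp (T := 1) 2 (k:ℤ))) :=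
      orthonormal_fourier.comp _ Nat.cast_injective
    have h5 := ho.inner_sum (fun k => taylorCoeff f k * (r:ℂ) ^ k)
      (fun k => taylorCoeff f k * (r:ℂ) ^ k) s
    rw [inner_self_eq_norm_sq_to_K] at h5
    have h6 : ∑ k ∈ s, ‖taylorCoeff f k‖ ^ 2 * r ^ (2 * k) =
        ‖∑ k ∈ s, (taylorCoeff f k * (r:ℂ) ^ k) • fourierLp (T := 1) 2 (k:ℤ)‖ ^ 2 := by
      apply Complex.ofReal_injective
      push_cast
      refine Eq.trans ?_ h5.symm
      refine Finset.sum_congr rfl fun k _ => ?_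
      rw [Complex.conj_mul', norm_mul, norm_pow, Complex.norm_real, Real.norm_of_nonneg h0]
      push_cast
      ring
    simp only [map_smul]
    exact h6.symm

theorem MemH2.mul_hinf {u h : ℂ → ℂ} (hu : MemHinf u) (hh : MemH2 h) :
    MemH2 (fun z => u z * h z) := by
  obtain ⟨hud, C, hC⟩ := hu
  obtain ⟨hhd, hhs⟩ := hh
  have hd : DifferentiableOn ℂ (fun z => u z * h z) unitDisk := hud.mul hhd
  refine ⟨hd, ?_⟩
  have hC0 : 0 ≤ C := (norm_nonneg _).trans (hC 0 (by simp [unitDisk]))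
  refine summable_of_sum_le (c := C ^ 2 * ∑' k, ‖taylorCoeff h k‖ ^ 2)
    (fun _ => by positivity) fun s => ?_
  have key : ∀ r ∈ Ico (0:ℝ) 1,
      ∑ k ∈ s, ‖taylorCoeff (fun z => u z * h z) k‖ ^ 2 * r ^ (2 * k) ≤
        C ^ 2 * ∑' k, ‖taylorCoeff h k‖ ^ 2 := by
    rintro r ⟨h0, h1⟩
    obtain ⟨F, hF, hFs⟩ := aux_parseval hd h0 h1
    obtain ⟨G, hG, hGs⟩ := aux_parseval hhd h0 h1
    have a1 := sum_le_hasSum s (fun k _ => by positivity) hFs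
    have a2 : ‖ContinuousMap.toLp (E := ℂ) 2 (AddCircle.haarAddCircle (T := 1)) ℂ F‖ ≤
        C * ‖ContinuousMap.toLp (E := ℂ) 2 (AddCircle.haarAddCircle (T := 1)) ℂ G‖ := by
      apply Lp.norm_le_mul_norm_of_ae_le_mul
      filter_upwards [ContinuousMap.coeFn_toLp (p := 2) (𝕜 := ℂ)
          (AddCircle.haarAddCircle (T := 1)) F,
        ContinuousMap.coeFn_toLp (p := 2) (𝕜 := ℂ)
          (AddCircle.haarAddCircle (T := 1)) G] with t ht1 ht2
      rw [ht1, ht2, hF, hG, norm_mul]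
      gcongr
      apply hC
      simp [unitDisk, abs_of_nonneg h0, h1, Circle.norm_coe]
    have a3 : ‖ContinuousMap.toLp (E := ℂ) 2 (AddCircle.haarAddCircle (T := 1)) ℂ G‖ ^ 2 ≤
        ∑' k, ‖taylorCoeff h k‖ ^ 2 := by
      refine hasSum_le (fun k => ?_) hGs hhs.hasSum
      exact mul_le_of_le_one_right (by positivity) (pow_le_one₀ h0 h1.le)
    calc _ ≤ _ := a1
      _ ≤ (C * ‖ContinuousMap.toLp (E := ℂ) 2 (AddCircle.haarAddCircle (T := 1)) ℂ G‖) ^ 2 := by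
        gcongr
      _ ≤ _ := by rw [mul_pow]; gcongr
  have hcont : Tendsto (fun r : ℝ =>
      ∑ k ∈ s, ‖taylorCoeff (fun z => u z * h z) k‖ ^ 2 * r ^ (2 * k)) (nhdsWithin 1 (Iio 1))
      (nhds (∑ k ∈ s, ‖taylorCoeff (fun z => u z * h z) k‖ ^ 2)) := by
    have : Continuous (fun r : ℝ =>
      ∑ k ∈ s, ‖taylorCoeff (fun z => u z * h z) k‖ ^ 2 * r ^ (2 * k)) := by fun_prop
    have := (this.tendsto 1).mono_left (nhdsWithin_le_nhds (s := Iio 1))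
    simpa using this
  refine le_of_tendsto hcont ?_
  filter_upwards [Ico_mem_nhdsLT (show (0:ℝ) < 1 by norm_num)] with r hr using key r hr

theorem MemH2.add_fun {u h : ℂ → ℂ} (hu : MemH2 u) (hh : MemH2 h) :
    MemH2 (fun z => u z + h z) := by
  refine ⟨hu.1.add hh.1, ?_⟩
  have h0 : unitDisk ∈ nhds (0:ℂ) := Metric.ball_mem_nhds _ one_pos
  have hc : ∀ k, taylorCoeff (fun z => u z + h z) k = taylorCoeff u k + taylorCoeff h k := by
    intro k
    have := iteratedDeriv_fun_add (n := k) (hu.1.analyticAt h0).contDiffAt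
      (hh.1.analyticAt h0).contDiffAt
    simp only [taylorCoeff, this, add_div]
  refine Summable.of_nonneg_of_le (fun _ => by positivity) (fun k => ?_)
    ((hu.2.add hh.2).mul_left 2)
  rw [hc]
  have := norm_add_le (taylorCoeff u k) (taylorCoeff h k)
  have h2 : ‖taylorCoeff u k + taylorCoeff h k‖ ^ 2 ≤ (‖taylorCoeff u k‖ + ‖taylorCoeff h k‖) ^ 2 := by
    gcongr
  nlinarith [sq_nonneg (‖taylorCoeff u k‖ - ‖taylorCoeff h k‖)]

theorem memHinf_poly (p : Polynomial ℂ) : MemHinf (fun z => p.eval z) := by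
  refine ⟨p.differentiable.differentiableOn, ?_⟩
  obtain ⟨C, hC⟩ := (isCompact_closedBall (0:ℂ) 1).exists_bound_of_continuousOn
    (f := fun z => p.eval z) p.continuous.continuousOn
  exact ⟨C, fun z hz => hC z (Metric.ball_subset_closedBall hz)⟩

theorem memH2_one : MemH2 (fun _ => 1) := by
  refine ⟨differentiableOn_const _, ?_⟩
  apply summable_of_ne_finset_zero (s := {0})
  intro k hk
  have hk : k ≠ 0 := by simpa using hk
  simp [taylorCoeff, iteratedDeriv_const, hk]

theorem memH2_poly (p : Polynomial ℂ) : MemH2 (fun z => p.eval z) := by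
  simpa using MemH2.mul_hinf (memHinf_poly p) memH2_one

theorem MemH2.growth {g : ℂ → ℂ} (hg : MemH2 g) :
    ∃ A : ℝ, 0 ≤ A ∧ ∀ z ∈ unitDisk, ‖g z‖ ^ 2 ≤ A * (1 - ‖z‖ ^ 2)⁻¹ := by
  refine ⟨∑' k, ‖taylorCoeff g k‖ ^ 2, tsum_nonneg fun _ => by positivity, fun z hz => ?_⟩
  have hz1 : ‖z‖ < 1 := by simpa [unitDisk] using hz
  have h := ((aux_hasSum hg.1 hz).norm.pow 2)
  refine le_of_tendsto' h fun s => ?_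
  have hgeo : HasSum (fun k => (‖z‖ ^ 2) ^ k) (1 - ‖z‖ ^ 2)⁻¹ :=
    hasSum_geometric_of_lt_one (by positivity) (pow_lt_one₀ (norm_nonneg _) hz1 two_ne_zero)
  calc ‖∑ k ∈ s, taylorCoeff g k * z ^ k‖ ^ 2 ≤ (∑ k ∈ s, ‖taylorCoeff g k‖ * ‖z‖ ^ k) ^ 2 := by
        gcongr
        refine (norm_sum_le _ _).trans_eq ?_
        simp
    _ ≤ (∑ k ∈ s, ‖taylorCoeff g k‖ ^ 2) * ∑ k ∈ s, (‖z‖ ^ k) ^ 2 :=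
        Finset.sum_mul_sq_le_sq_mul_sq _ _ _
    _ ≤ _ := by
        gcongr
        · exact hg.2.sum_le_tsum s fun _ _ => by positivity
        · refine le_trans (le_of_eq ?_) (sum_le_hasSum s (fun k _ => by positivity) hgeo)
          exact Finset.sum_congr rfl fun k _ => by rw [← pow_mul, ← pow_mul, mul_comm]

/-- If `φ = (z - ξ)(u g + v)` with `g ∈ H²` and `u, v` polynomials, then `φ` has radial limit
zero at `ξ`. -/
theorem aux_radial {g : ℂ → ℂ} (hg : MemH2 g) (u v : Polynomial ℂ) {ξ : ℂ} (hξ : ‖ξ‖ = 1) :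
    Tendsto (fun r : ℝ => ‖((r:ℂ) * ξ - ξ) * (u.eval ((r:ℂ) * ξ) * g ((r:ℂ) * ξ) +
      v.eval ((r:ℂ) * ξ))‖) (nhdsWithin 1 (Iio 1)) (nhds 0) := by
  obtain ⟨A, hA, hgA⟩ := hg.growth
  obtain ⟨_, U, hU⟩ := memHinf_poly u
  obtain ⟨_, V, hV⟩ := memHinf_poly v
  have hlim : Tendsto (fun r : ℝ => U * √A * √(1 - r) + V * (1 - r)) (nhdsWithin 1 (Iio 1))
      (nhds 0) := by
    have : Continuous (fun r : ℝ => U * √A * √(1 - r) + V * (1 - r)) := by fun_prop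
    have := (this.tendsto 1).mono_left (nhdsWithin_le_nhds (s := Iio 1))
    simpa using this
  refine tendsto_of_tendsto_of_tendsto_of_le_of_le' tendsto_const_nhds hlim
    (Eventually.of_forall fun _ => norm_nonneg _) ?_
  filter_upwards [Ico_mem_nhdsLT (show (0:ℝ) < 1 by norm_num)] with r hr
  obtain ⟨h0, h1⟩ := hr
  have hn : ‖(r:ℂ) * ξ‖ = r := by simp [hξ, abs_of_nonneg h0]
  have hz : (r:ℂ) * ξ ∈ unitDisk := by simp [unitDisk, hξ, abs_of_nonneg h0, h1]
  have hU0 : 0 ≤ U := (norm_nonneg _).trans (hU _ hz)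
  have e1 : ‖(r:ℂ) * ξ - ξ‖ = 1 - r := by
    have : (r:ℂ) * ξ - ξ = ((r - 1 : ℝ) : ℂ) * ξ := by push_cast; ring
    rw [this, norm_mul, hξ, mul_one, Complex.norm_real, Real.norm_eq_abs, abs_of_neg (by linarith)]
    ring
  have e2 : ‖g ((r:ℂ) * ξ)‖ * (1 - r) ≤ √A * √(1 - r) := by
    have := hgA _ hz
    rw [hn] at this
    rw [← Real.sqrt_mul hA]
    apply Real.le_sqrt_of_sq_le
    have h2 : (1 - r ^ 2)⁻¹ ≤ (1 - r)⁻¹ := by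
      apply inv_anti₀ (by linarith); nlinarith
    calc (‖g ((r:ℂ) * ξ)‖ * (1 - r)) ^ 2 = ‖g ((r:ℂ) * ξ)‖ ^ 2 * (1 - r) ^ 2 := by ring
      _ ≤ (A * (1 - r)⁻¹) * (1 - r) ^ 2 := by
        gcongr
        exact this.trans (by gcongr)
      _ = A * (1 - r) := by
        have : 1 - r ≠ 0 := by linarith
        field_simp
  rw [norm_mul, e1]
  calc (1 - r) * ‖u.eval ((r:ℂ) * ξ) * g ((r:ℂ) * ξ) + v.eval ((r:ℂ) * ξ)‖
      ≤ (1 - r) * (U * ‖g ((r:ℂ) * ξ)‖ + V) := by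
        refine mul_le_mul_of_nonneg_left ?_ (by linarith)
        refine (norm_add_le _ _).trans ?_
        rw [norm_mul]
        exact add_le_add (mul_le_mul_of_nonneg_right (hU _ hz) (norm_nonneg _)) (hV _ hz)
    _ = U * (‖g ((r:ℂ) * ξ)‖ * (1 - r)) + V * (1 - r) := by ring
    _ ≤ U * (√A * √(1 - r)) + V * (1 - r) := by gcongr
    _ = _ := by ring

/-- Lemma 2.1. If `b` is rational in the closed unit ball of `H^∞`
(`‖b‖_∞ = 1`, not a finite Blaschke product), `φ ∈ H(b)` and `1/φ ∈ H^∞`, then `1/φ` is a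
multiplier of `H(b)`. -/
theorem inverse_is_multiplier
    (b a : ℂ → ℂ) (n : ℕ) (ξ : Fin n → ℂ) (m : Fin n → ℕ)
    (hset : RationalSetting b a n ξ m)
    (φ : ℂ → ℂ) (hφ : MemHb ξ m φ)
    (hinv : MemHinf fun z => (φ z)⁻¹) :
    ∀ f, MemHb ξ m f → MemHb ξ m fun z => (φ z)⁻¹ * f z := by
  obtain ⟨⟨g, q⟩, hg, hq, hφe⟩ := hφ
  simp only at hg hq hφe
  rintro f ⟨⟨h, p⟩, hh, hp, hfe⟩
  simp only at hh hp hfe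
  obtain ⟨A, hA⟩ : ∃ A : Polynomial ℂ, A = ∏ j, (Polynomial.X - Polynomial.C (ξ j)) ^ m j :=
    ⟨_, rfl⟩
  have hAe : ∀ z, a1fun ξ m z = A.eval z := by
    intro z
    simp [hA, a1fun, Polynomial.eval_prod]
  have hAm : A.Monic := by
    rw [hA]
    exact Polynomial.monic_prod_of_monic _ _ fun j _ => (Polynomial.monic_X_sub_C _).pow _
  have hAd : A.degree = ((∑ j, m j : ℕ) : WithBot ℕ) := by
    rw [Polynomial.degree_eq_natDegree hAm.ne_zero, hA,
      Polynomial.natDegree_prod_of_monic _ _ fun j _ => (Polynomial.monic_X_sub_C _).pow _]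
    simp
  have hφd : DifferentiableOn ℂ φ unitDisk := by
    have : DifferentiableOn ℂ (fun z => A.eval z * g z + q.eval z) unitDisk :=
      (A.differentiable.differentiableOn.mul hg.1).add q.differentiable.differentiableOn
    refine this.congr fun z hz => ?_
    rw [hφe z hz, hAe]
  by_cases hzero : ∃ z ∈ unitDisk, φ z = 0
  · obtain ⟨w, hw, hw0⟩ := hzero
    have hall : ∀ z ∈ unitDisk, φ z = 0 := by
      intro z hz
      have hpc : IsPreconnected unitDisk := (convex_ball (0:ℂ) 1).isPreconnected
      have hc : ContinuousOn (fun z => φ z * (φ z)⁻¹) unitDisk :=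
        hφd.continuousOn.mul hinv.1.continuousOn
      have hfin : ({0, 1} : Set ℂ).Finite := by simp
      have hm : MapsTo (fun z => φ z * (φ z)⁻¹) unitDisk ({0, 1} : Set ℂ) := by
        intro x _
        by_cases hx : φ x = 0
        · simp [hx]
        · simp [hx]
      have h1 := hpc.constant_of_mapsTo hfin.isDiscrete hc hm hz hw
      simpa [hw0] using h1
    refine ⟨(fun z => (0 : Polynomial ℂ).eval z, 0), memH2_poly 0, ?_, fun z hz => ?_⟩
    · rw [Polynomial.degree_zero]
      exact WithBot.bot_lt_coe _
    · simp [hall z hz]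
  push Not at hzero
  obtain ⟨_, C, hC⟩ := id hinv
  have hq0 : ∀ j, q.eval (ξ j) ≠ 0 := by
    intro j hj
    have hξ : ‖ξ j‖ = 1 := by simpa [unitCircle] using hset.zeros_mem j
    obtain ⟨v, hv⟩ := Polynomial.dvd_iff_isRoot.mpr hj
    have hdA : Polynomial.X - Polynomial.C (ξ j) ∣ A := by
      rw [hA]
      exact (dvd_pow_self _ (hset.mult_pos j).ne').trans
        (Finset.dvd_prod_of_mem (fun j => (Polynomial.X - Polynomial.C (ξ j)) ^ m j)
          (Finset.mem_univ j))
    obtain ⟨u, hu⟩ := hdA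
    have ht := (aux_radial hg u v hξ).const_mul C
    rw [mul_zero] at ht
    have : (1:ℝ) ≤ 0 := by
      refine ge_of_tendsto ht ?_
      filter_upwards [Ico_mem_nhdsLT (show (0:ℝ) < 1 by norm_num)] with r hr
      obtain ⟨h0, h1⟩ := hr
      have hz : (r:ℂ) * ξ j ∈ unitDisk := by simp [unitDisk, hξ, abs_of_nonneg h0, h1]
      have e : φ ((r:ℂ) * ξ j) = ((r:ℂ) * ξ j - ξ j) * (u.eval ((r:ℂ) * ξ j) * g ((r:ℂ) * ξ j) +
          v.eval ((r:ℂ) * ξ j)) := by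
        rw [hφe _ hz, hAe, hu, hv]
        simp only [Polynomial.eval_mul, Polynomial.eval_sub, Polynomial.eval_X, Polynomial.eval_C]
        ring
      rw [← e]
      have h2 := hC _ hz
      have h3 : ‖(φ ((r:ℂ) * ξ j))⁻¹‖ * ‖φ ((r:ℂ) * ξ j)‖ = 1 := by
        rw [← norm_mul, inv_mul_cancel₀ (hzero _ hz), norm_one]
      rw [← h3]
      gcongr
    linarith
  have hcop : IsCoprime q A := by
    rw [hA]
    refine IsCoprime.prod_right fun j _ => IsCoprime.pow_right ?_
    refine IsCoprime.symm ?_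
    rw [(Polynomial.irreducible_X_sub_C (ξ j)).coprime_iff_not_dvd, Polynomial.dvd_iff_isRoot]
    exact hq0 j
  obtain ⟨r, s, hrs⟩ := hcop
  refine ⟨(fun z => (φ z)⁻¹ * ((h z + (p * s).eval z) + (-(p * r)).eval z * g z) +
    ((p * r) /ₘ A).eval z, (p * r) %ₘ A), ?_, ?_, fun z hz => ?_⟩
  · exact ((hh.add_fun (memH2_poly _)).add_fun
      (MemH2.mul_hinf (memHinf_poly _) hg)).mul_hinf hinv |>.add_fun (memH2_poly _)
  · rw [← hAd]
    exact Polynomial.degree_modByMonic_lt _ hAm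
  · have hz0 := hzero z hz
    have e1 := congrArg (Polynomial.eval z) hrs
    have e2 := congrArg (Polynomial.eval z) (Polynomial.modByMonic_add_div (p * r) A)
    have e3 := hφe z hz
    simp only [Polynomial.eval_add, Polynomial.eval_mul, Polynomial.eval_one,
      Polynomial.eval_neg] at e1 e2 ⊢
    rw [hAe] at e3 ⊢
    rw [hfe z hz, hAe]
    have e4 : φ z * (φ z)⁻¹ = 1 := mul_inv_cancel₀ hz0
    linear_combination (-(p.eval z) * (φ z)⁻¹) * e1 - e2 +
      p.eval z * r.eval z * e4 - (φ z)⁻¹ * p.eval z * r.eval z * e3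

end
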